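/- arXiv:2508.02985 — 3 statements merged into one kernel-verified Lean document; each statement's English description precedes it below -/
import Mathlib

section
/- Every finite triangle-free simple graph G with at least one vertex satisfies φ(G) ≥ χ(G) − 2, where φ(G) is the chromatic discrepancy and χ(G) the chromatic number of G. -/
open SimpleGraph

/-- `σ` is a proper colouring of `G` with colours in `ℕ`. -/
def IsProperColoring {V : Type*} (G : SimpleGraph V) (σ : V → ℕ) : Prop :=
  ∀ ⦃u v : V⦄, G.Adj u v → σ u ≠ σ v

/-- The chromatic number of `G`, as a natural number. -/
noncomputable def chromNum {V : Type*} (G : SimpleGraph V) : ℕ :=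
  sInf {n : ℕ | G.Colorable n}

/-- The discrepancy `φ_σ(G)` of a proper colouring `σ` of `G`: the maximum, over all
induced subgraphs `G[S]` of `G`, of `|σ(S)| - χ(G[S])`. -/
noncomputable def colDisc {V : Type*} (G : SimpleGraph V) (σ : V → ℕ) : ℤ :=
  sSup {z : ℤ | ∃ S : Set V, z = ((σ '' S).ncard : ℤ) - (chromNum (G.induce S) : ℤ)}

/-- The chromatic discrepancy `φ(G)`: the minimum of `φ_σ(G)` over all proper
colourings `σ` of `G`. -/
noncomputable def chromDisc {V : Type*} (G : SimpleGraph V) : ℤ :=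
  sInf {z : ℤ | ∃ σ : V → ℕ, IsProperColoring G σ ∧ z = colDisc G σ}

/-- `G` is locally `s`-colourable: the closed neighbourhood of every vertex induces an
`s`-colourable subgraph. -/
def LocallyColorable {V : Type*} (G : SimpleGraph V) (s : ℕ) : Prop :=
  ∀ v : V, chromNum (G.induce (insert v (G.neighborSet v))) ≤ s

/-- The set of vertices at distance at most `r` from `v` in `G`. -/
def ballSet {V : Type*} (G : SimpleGraph V) (v : V) (r : ℕ) : Set V :=
  {u : V | ∃ w : G.Walk v u, w.length ≤ r}

/-- `G` is `r`-locally `s`-colourable: every ball of radius `r` induces an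
`s`-colourable subgraph. -/
def RLocallyColorable {V : Type*} (G : SimpleGraph V) (r s : ℕ) : Prop :=
  ∀ v : V, chromNum (G.induce (ballSet G v r)) ≤ s

/-- `G` contains no cycle of length exactly `n` as a (not necessarily induced) subgraph. -/
def CycleLenFree {V : Type*} (G : SimpleGraph V) (n : ℕ) : Prop :=
  ∀ (v : V) (w : G.Walk v v), w.IsCycle → w.length ≠ n

/-- `H` is `k`-degenerate: every non-empty (induced) subgraph contains a vertex of
degree at most `k` in it. -/
def Degenerate {α : Type*} (H : SimpleGraph α) (k : ℕ) : Prop :=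
  ∀ S : Set α, S.Nonempty → ∃ a ∈ S, {b | b ∈ S ∧ H.Adj a b}.ncard ≤ k

/-- `G` is co-locally `s`-colourable: for all vertices `u ≠ v`,
`χ(G[{u} ∪ N(v)]) ≤ s`. -/
def CoLocallyColorable {V : Type*} (G : SimpleGraph V) (s : ℕ) : Prop :=
  ∀ v u : V, u ≠ v → chromNum (G.induce (insert u (G.neighborSet v))) ≤ s

/-- The minimum of `χ(G[X])` over all subsets `X ⊆ V(G)` spanning exactly `p` colours
of `σ` (a rainbow cover of `σ` when `σ` uses exactly `p` colours). -/
noncomputable def minRainbowChrom {V : Type*} (G : SimpleGraph V) (σ : V → ℕ) (p : ℕ) : ℕ :=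
  sInf {c : ℕ | ∃ X : Set V, (σ '' X).ncard = p ∧ c = chromNum (G.induce X)}

/-- `f_G(p)`: the maximum, over all proper colourings `σ` of `G` using exactly `p`
colours, of the minimum chromatic number of a rainbow cover of `σ`. -/
noncomputable def fG {V : Type*} (G : SimpleGraph V) (p : ℕ) : ℕ :=
  sSup {m : ℕ | ∃ σ : V → ℕ, IsProperColoring G σ ∧ (σ '' Set.univ).ncard = p ∧
    m = minRainbowChrom G σ p}

/-- The closed neighbourhood `N[X]` of a set `X` of vertices. -/
def closedNbhd {V : Type*} (G : SimpleGraph V) (X : Set V) : Set V :=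
  X ∪ {u : V | ∃ x ∈ X, G.Adj x u}

/-- `τ` is a proper colouring of `G[T]` with colours `< c`. -/
def ColOn {V : Type*} (G : SimpleGraph V) (T : Finset V) (τ : V → ℕ) (c : ℕ) : Prop :=
  (∀ x ∈ T, τ x < c) ∧ ∀ x ∈ T, ∀ y ∈ T, G.Adj x y → τ x ≠ τ y

lemma ColOn.chromNum_le {V : Type*} {G : SimpleGraph V} {T : Finset V} {τ : V → ℕ} {c : ℕ}
    (h : ColOn G T τ c) : chromNum (G.induce (T : Set V)) ≤ c := by
  apply Nat.sInf_le
  refine ⟨Coloring.mk (fun x => (⟨τ x.1, h.1 x.1 x.2⟩ : Fin c)) ?_⟩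
  intro x y hxy hc
  exact h.2 x.1 x.2 y.1 y.2 hxy (by simpa using hc)

lemma exists_small_injOn (A : Finset ℕ) :
    ∃ e : ℕ → ℕ, (∀ x ∈ A, e x < A.card) ∧ ∀ x ∈ A, ∀ y ∈ A, e x = e y → x = y := by
  classical
  refine ⟨fun x => if h : x ∈ A then (A.equivFin ⟨x, h⟩ : ℕ) else 0, ?_, ?_⟩
  · intro x hx
    simp [hx]
  · intro x hx y hy h
    simp only [hx, hy, dif_pos] at h
    have := A.equivFin.injective (Fin.ext h)
    simpa using this

open Classical in
lemma main_step {V : Type*} [Fintype V] (G : SimpleGraph V) (hG : G.CliqueFree 3)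
    (σ : V → ℕ) (hσ : IsProperColoring G σ) (n : ℕ) :
    ∀ T : Finset V, T.card = n → ∃ S : Finset V, S ⊆ T ∧ ∃ (m c : ℕ) (ρ τ : V → ℕ), 2 ≤ c ∧
      ColOn G T τ c ∧ ColOn G S ρ m ∧ c + m ≤ (S.image σ).card + 2 := by
  induction n using Nat.strong_induction_on with
  | _ n ih =>
  intro T hT
  by_cases hE : ∃ x ∈ T, ∃ y ∈ T, G.Adj x y
  swap
  · push Not at hE
    refine ⟨∅, by simp, 0, 2, fun _ => 0, fun _ => 0, le_rfl, ⟨by simp, ?_⟩, ⟨by simp, by simp⟩,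
      by simp⟩
    intro x hx y hy hxy
    exact absurd hxy (hE x hx y hy)
  obtain ⟨x0, hx0, y0, hy0, hxy0⟩ := hE
  let N : V → Finset V := fun v => T.filter (fun w => G.Adj v w)
  obtain ⟨v, hv, hmax⟩ := Finset.exists_max_image T (fun v => ((N v).image σ).card) ⟨x0, hx0⟩
  set A := (N v).image σ with hA
  have hApos : 0 < A.card := by
    refine lt_of_lt_of_le ?_ (hmax x0 hx0)
    apply Finset.card_pos.mpr
    exact ⟨σ y0, Finset.mem_image_of_mem _ (by simp [N, hy0, hxy0])⟩
  let T' := T.filter (fun x => σ x ∉ A)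
  have hlt : T'.card < n := by
    rw [← hT]
    apply Finset.card_lt_card
    refine Finset.filter_ssubset.mpr ?_
    obtain ⟨a, ha⟩ := Finset.card_pos.mp hApos
    obtain ⟨w, hw, rfl⟩ := Finset.mem_image.mp ha
    exact ⟨w, (Finset.mem_filter.mp hw).1, by simpa using ha⟩
  obtain ⟨S', hS', m, c, ρ, τ, hc, hτ, hρ, hcard⟩ := ih _ hlt T' rfl
  have hT' : ∀ x, x ∈ T' ↔ x ∈ T ∧ σ x ∉ A := fun x => Finset.mem_filter
  obtain ⟨e, he1, he2⟩ := exists_small_injOn A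
  have hmiss : ∀ y, ∃ i, (y ∈ T → (∃ z ∈ T', G.Adj y z) →
      i ∈ A ∧ ∀ w ∈ T, G.Adj y w → σ w ≠ i) := by
    intro y
    by_cases h : y ∈ T ∧ ∃ z ∈ T', G.Adj y z
    swap
    · exact ⟨0, fun h1 h2 => absurd ⟨h1, h2⟩ h⟩
    obtain ⟨hy, z, hz, hyz⟩ := h
    by_contra hcon
    push Not at hcon
    have hsub : insert (σ z) A ⊆ (N y).image σ := by
      intro i hi
      rcases Finset.mem_insert.mp hi with rfl | hi
      · exact Finset.mem_image_of_mem _ (by simp [N, hyz, ((hT' z).1 hz).1])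
      · obtain ⟨w, hw, hyw, rfl⟩ := (hcon i).2.2 hi
        exact Finset.mem_image_of_mem _ (by simp [N, hyw, hw])
    have h1 := Finset.card_le_card hsub
    rw [Finset.card_insert_of_notMem ((hT' z).1 hz).2] at h1
    have h2 := hmax y hy
    omega
  choose μ hμ using hmiss
  let τ' : V → ℕ := fun x =>
    if σ x ∈ A then c - 1 + e (σ x)
    else if ∃ z ∈ T', G.Adj x z then
      (if τ x = c - 1 then c - 1 + e (μ x) else τ x)
    else 0
  refine ⟨S' ∪ N v, ?_, m + 1, c - 1 + A.card, fun x => if x ∈ N v then m else ρ x, τ',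
    by omega, ⟨?_, ?_⟩, ⟨?_, ?_⟩, ?_⟩
  · intro x hx
    rcases Finset.mem_union.mp hx with hx | hx
    · exact ((hT' x).1 (hS' hx)).1
    · exact (Finset.mem_filter.mp hx).1
  · intro x hx
    simp only [τ']
    split_ifs with h1 h2 h3
    · have := he1 _ h1; omega
    · have := he1 _ (hμ x hx h2).1; omega
    · have := hτ.1 x ((hT' x).2 ⟨hx, h1⟩); omega
    · omega
  · -- properness
    have key : ∀ x ∈ T, ∀ y ∈ T, G.Adj x y → σ x ∈ A → τ' x ≠ τ' y := by
      intro x hx y hy hxy h1 heq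
      simp only [τ', if_pos h1] at heq
      split_ifs at heq with h2 h3 h4
      · exact hσ hxy (he2 _ h1 _ h2 (by omega))
      · have hm := hμ y hy h3
        exact hm.2 x hx hxy.symm (he2 _ h1 _ hm.1 (by omega))
      · have := hτ.1 y ((hT' y).2 ⟨hy, h2⟩); omega
      · omega
    intro x hx y hy hxy
    by_cases h1 : σ x ∈ A
    · exact key x hx y hy hxy h1
    by_cases h2 : σ y ∈ A
    · exact (key y hy x hx hxy.symm h2).symm
    have hx' := (hT' x).2 ⟨hx, h1⟩
    have hy' := (hT' y).2 ⟨hy, h2⟩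
    have hne := hτ.2 x hx' y hy' hxy
    have hxb := hτ.1 x hx'
    have hyb := hτ.1 y hy'
    have e1 : ∃ z ∈ T', G.Adj x z := ⟨y, hy', hxy⟩
    have e2 : ∃ z ∈ T', G.Adj y z := ⟨x, hx', hxy.symm⟩
    simp only [τ', if_neg h1, if_neg h2, if_pos e1, if_pos e2]
    split_ifs <;> omega
  · intro x hx
    simp only
    split_ifs with h
    · omega
    · have := hρ.1 x ((Finset.mem_union.mp hx).resolve_right h); omega
  · intro x hx y hy hxy
    simp only
    split_ifs with h1 h2 h2
    · exfalso
      have a1 := (Finset.mem_filter.mp h1).2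
      have a2 := (Finset.mem_filter.mp h2).2
      exact hG {v, x, y} (is3Clique_triple_iff.mpr ⟨a1, a2, hxy⟩)
    · have := hρ.1 y ((Finset.mem_union.mp hy).resolve_right h2); omega
    · have := hρ.1 x ((Finset.mem_union.mp hx).resolve_right h1); omega
    · exact hρ.2 x ((Finset.mem_union.mp hx).resolve_right h1) y
        ((Finset.mem_union.mp hy).resolve_right h2) hxy
  · rw [Finset.image_union, Finset.card_union_of_disjoint, ← hA]
    · omega
    · rw [← hA, Finset.disjoint_left]
      intro i hi
      obtain ⟨w, hw, rfl⟩ := Finset.mem_image.mp hi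
      exact ((hT' w).1 (hS' hw)).2

/-- Every finite triangle-free simple graph `G` with at least one vertex
satisfies `φ(G) ≥ χ(G) - 2`. -/
theorem triangleFree_chromDisc {V : Type*} [Fintype V] [Nonempty V]
    (G : SimpleGraph V) (hG : G.CliqueFree 3) :
    chromDisc G ≥ (chromNum G : ℤ) - 2 := by
  classical
  apply le_csInf
  · refine ⟨_, fun v => (Fintype.equivFin V v : ℕ), ?_, rfl⟩
    intro u v huv h
    exact huv.ne ((Fintype.equivFin V).injective (Fin.ext h))
  rintro z ⟨σ, hσ, rfl⟩
  obtain ⟨S, -, m, c, ρ, τ, -, hτ, hρ, hcard⟩ :=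
    main_step G hG σ hσ _ Finset.univ rfl
  have h1 : chromNum G ≤ c := by
    apply Nat.sInf_le
    refine ⟨Coloring.mk (fun x => (⟨τ x, hτ.1 x (Finset.mem_univ x)⟩ : Fin c)) ?_⟩
    intro x y hxy hc
    exact hτ.2 x (Finset.mem_univ x) y (Finset.mem_univ y) hxy (by simpa using hc)
  have h2 := hρ.chromNum_le
  have h3 : (σ '' (S : Set V)).ncard = (S.image σ).card := by
    rw [← Finset.coe_image, Set.ncard_coe_finset]
  have h4 : ((σ '' (S : Set V)).ncard : ℤ) - (chromNum (G.induce (S : Set V)) : ℤ)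
      ≤ colDisc G σ := by
    apply le_csSup
    · refine ⟨(Fintype.card V : ℤ), ?_⟩
      rintro z ⟨R, rfl⟩
      have : (σ '' R).ncard ≤ Fintype.card V := by
        refine (Set.ncard_image_le R.toFinite).trans ?_
        rw [← Nat.card_eq_fintype_card]
        exact Set.ncard_le_card R
      omega
    · exact ⟨_, rfl⟩
  omega
end

section
/- For every integer s ≥ 2, every finite locally s-colourable simple graph G with at least one vertex whose chromatic number χ satisfies χ < (11s+16)/6 has chromatic discrepancy φ(G) ≥ χ − s. -/
open SimpleGraph

/-! ### Colourings of finite vertex sets -/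

section Helpers

variable {V : Type*} (G : SimpleGraph V)

def PropOn (X : Finset V) (c : V → ℕ) : Prop :=
  ∀ x ∈ X, ∀ y ∈ X, G.Adj x y → c x ≠ c y

def Col (X : Finset V) (k : ℕ) : Prop :=
  ∃ c : V → ℕ, (∀ x ∈ X, c x < k) ∧ PropOn G X c

noncomputable def chi (X : Finset V) : ℕ := sInf {k | Col G X k}

variable {G}

lemma chi_le {X : Finset V} {k : ℕ} (h : Col G X k) : chi G X ≤ k := Nat.sInf_le h

open Classical in
lemma col_image {X : Finset V} {c : V → ℕ} (h : PropOn G X c) : Col G X (X.image c).card := by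
  classical
  let e := (X.image c).equivFin
  refine ⟨fun x => if hx : c x ∈ X.image c then (e ⟨c x, hx⟩ : ℕ) else 0, ?_, ?_⟩
  · intro x hx
    have : c x ∈ X.image c := Finset.mem_image_of_mem c hx
    simp only [this, dif_pos]
    exact (e ⟨c x, this⟩).2
  · intro x hx y hy hxy
    have h1 : c x ∈ X.image c := Finset.mem_image_of_mem c hx
    have h2 : c y ∈ X.image c := Finset.mem_image_of_mem c hy
    simp only [h1, h2, dif_pos]
    intro h3
    have h4 := e.injective (Fin.ext h3)
    exact h x hx y hy hxy (congrArg Subtype.val h4)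

open Classical in
lemma chi_le_image {X : Finset V} {c : V → ℕ} (h : PropOn G X c) :
    chi G X ≤ (X.image c).card := chi_le (col_image h)

lemma exists_inj (X : Finset V) : ∃ c : V → ℕ, PropOn G X c := by
  classical
  let e := X.equivFin
  refine ⟨fun x => if hx : x ∈ X then (e ⟨x, hx⟩ : ℕ) else 0, ?_⟩
  intro x hx y hy hxy
  simp only [hx, hy, dif_pos]
  intro h3
  have h4 := e.injective (Fin.ext h3)
  exact hxy.ne (congrArg Subtype.val h4)

lemma chi_spec (X : Finset V) : Col G X (chi G X) := by
  classical
  obtain ⟨c, hc⟩ := exists_inj (G := G) X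
  exact Nat.sInf_mem (s := {k | Col G X k}) ⟨_, col_image hc⟩

lemma chi_le_card (X : Finset V) : chi G X ≤ X.card := by
  classical
  obtain ⟨c, hc⟩ := exists_inj (G := G) X
  exact (chi_le_image hc).trans Finset.card_image_le

lemma PropOn.mono {X Y : Finset V} {c : V → ℕ} (h : PropOn G Y c) (hXY : X ⊆ Y) :
    PropOn G X c := fun x hx y hy => h x (hXY hx) y (hXY hy)

lemma chi_mono {X Y : Finset V} (h : X ⊆ Y) : chi G X ≤ chi G Y := by
  obtain ⟨c, hc, hp⟩ := chi_spec (G := G) Y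
  exact chi_le ⟨c, fun x hx => hc x (h hx), hp.mono h⟩

open Classical in
lemma chi_union (X Y : Finset V) : chi G (X ∪ Y) ≤ chi G X + chi G Y := by
  obtain ⟨c, hc, hp⟩ := chi_spec (G := G) X
  obtain ⟨d, hd, hq⟩ := chi_spec (G := G) Y
  refine chi_le ⟨fun x => if x ∈ X then c x else chi G X + d x, ?_, ?_⟩
  · intro x hx
    by_cases h : x ∈ X
    · simp only [h, if_true]; have := hc x h; omega
    · have hy : x ∈ Y := by simpa [h] using hx
      simp only [h, if_false]; have := hd x hy; omega
  · intro x hx y hy hxy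
    by_cases h : x ∈ X <;> by_cases h' : y ∈ X <;> simp only [h, h', if_true, if_false]
    · exact hp x h y h' hxy
    · have := hc x h; omega
    · have := hc y h'; omega
    · have hx : x ∈ Y := by simpa [h] using hx
      have hy : y ∈ Y := by simpa [h'] using hy
      have := hq x hx y hy hxy
      omega

open Classical in
lemma chi_join {S T : Finset V} (h : ∀ a ∈ S, ∀ b ∈ T, G.Adj a b) :
    chi G S + chi G T ≤ chi G (S ∪ T) := by
  obtain ⟨c, hc, hp⟩ := chi_spec (G := G) (S ∪ T)
  have h1 := chi_le_image (hp.mono (Finset.subset_union_left : S ⊆ S ∪ T))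
  have h2 := chi_le_image (hp.mono (Finset.subset_union_right : T ⊆ S ∪ T))
  have hd : Disjoint (S.image c) (T.image c) := by
    rw [Finset.disjoint_left]
    intro k hk hk'
    obtain ⟨a, ha, rfl⟩ := Finset.mem_image.1 hk
    obtain ⟨b, hb, hab⟩ := Finset.mem_image.1 hk'
    exact hp a (by simp [ha]) b (by simp [hb]) (h a ha b hb) hab.symm
  have h3 : S.image c ∪ T.image c ⊆ Finset.range (chi G (S ∪ T)) := by
    rw [← Finset.image_union]
    intro k hk
    obtain ⟨a, ha, rfl⟩ := Finset.mem_image.1 hk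
    exact Finset.mem_range.2 (hc a ha)
  have h4 := Finset.card_le_card h3
  rw [Finset.card_union_of_disjoint hd, Finset.card_range] at h4
  omega

open Classical in
lemma chi_insert_isolated {v : V} {R : Finset V} (h : ∀ a ∈ R, ¬ G.Adj v a) :
    chi G (insert v R) ≤ max 1 (chi G R) := by
  obtain ⟨c, hc, hp⟩ := chi_spec (G := G) R
  refine chi_le ⟨fun x => if x = v then 0 else c x, ?_, ?_⟩
  · intro x hx
    by_cases hxv : x = v
    · simp [hxv]
    · have : x ∈ R := by simpa [hxv] using hx
      simp only [hxv, if_false]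
      exact lt_of_lt_of_le (hc x this) (le_max_right _ _)
  · intro x hx y hy hxy
    by_cases hxv : x = v <;> by_cases hyv : y = v
    · subst hxv; subst hyv; exact absurd hxy (G.irrefl)
    · subst hxv
      exact absurd hxy (h y (by simpa [hyv] using hy))
    · subst hyv
      exact absurd hxy.symm (h x (by simpa [hxv] using hx))
    · simp only [hxv, hyv, if_false]
      exact hp x (by simpa [hxv] using hx) y (by simpa [hyv] using hy) hxy

lemma chi_indep {I : Finset V} (h : ∀ a ∈ I, ∀ b ∈ I, ¬ G.Adj a b) : chi G I ≤ 1 :=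
  chi_le ⟨fun _ => 0, fun _ _ => by simp, fun a ha b hb hab => absurd hab (h a ha b hb)⟩

lemma chi_pos {X : Finset V} (h : X.Nonempty) : 1 ≤ chi G X := by
  obtain ⟨x, hx⟩ := h
  obtain ⟨c, hc, -⟩ := chi_spec (G := G) X
  have := hc x hx
  omega

lemma chi_empty : chi G (∅ : Finset V) = 0 := by
  have := chi_le_card (G := G) (∅ : Finset V)
  simpa using this

lemma chi_clique {K : Finset V} (h : ∀ a ∈ K, ∀ b ∈ K, a ≠ b → G.Adj a b) :
    K.card ≤ chi G K := by
  classical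
  obtain ⟨c, hc, hp⟩ := chi_spec (G := G) K
  have := Finset.card_le_card_of_injOn (s := K) (t := Finset.range (chi G K)) c
    (fun a ha => by simpa using hc a ha)
    (fun a ha b hb hab => by
      by_contra hne
      exact hp a ha b hb (h a ha b hb hne) hab)
  simpa using this

/-! ### Gallai's theorem on critical graphs -/

open Classical in
def Opt (G : SimpleGraph V) (X : Finset V) (c : V → ℕ) : Prop :=
  PropOn G X c ∧ (X.image c).card ≤ chi G X

open Classical in
noncomputable def sing (X : Finset V) (c : V → ℕ) : Finset V :=
  X.filter (fun x => ∀ y ∈ X, c y = c x → y = x)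

lemma mem_sing {X : Finset V} {c : V → ℕ} {x : V} :
    x ∈ sing X c ↔ x ∈ X ∧ ∀ y ∈ X, c y = c x → y = x := by
  classical
  simp [sing]

lemma Opt.adj {X : Finset V} {c : V → ℕ} (h : Opt G X c) {u v : V} (hu : u ∈ sing X c)
    (hv : v ∈ sing X c) (huv : u ≠ v) : G.Adj u v := by
  classical
  by_contra hna
  rw [mem_sing] at hu hv
  have hp : PropOn G X (fun y => if y = u then c v else c y) := by
    intro x hx y hy hxy
    by_cases hxu : x = u <;> by_cases hyu : y = u
    · subst hxu; subst hyu; exact absurd hxy G.irrefl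
    · simp only [hxu, hyu, if_true, if_false]
      intro h1
      have := hv.2 y hy h1.symm
      subst this; subst hxu; exact hna hxy
    · simp only [hxu, hyu, if_true, if_false]
      intro h1
      have := hv.2 x hx h1
      subst this; subst hyu; exact hna hxy.symm
    · simp only [hxu, hyu, if_false]
      exact h.1 x hx y hy hxy
  have h1 := chi_le_image hp
  have h2 : X.image (fun y => if y = u then c v else c y) ⊆ (X.image c).erase (c u) := by
    intro k hk
    obtain ⟨y, hy, rfl⟩ := Finset.mem_image.1 hk
    by_cases hyu : y = u
    · simp only [hyu, if_true]
      refine Finset.mem_erase.2 ⟨fun h3 => huv (hu.2 v hv.1 h3).symm, Finset.mem_image_of_mem c hv.1⟩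
    · simp only [hyu, if_false]
      exact Finset.mem_erase.2 ⟨fun h3 => hyu (hu.2 y hy h3), Finset.mem_image_of_mem c hy⟩
  have h3 := Finset.card_le_card h2
  have h4 : c u ∈ X.image c := Finset.mem_image_of_mem c hu.1
  rw [Finset.card_erase_of_mem h4] at h3
  have h5 := Finset.card_pos.2 ⟨_, h4⟩
  have := h.2
  omega

open Classical in
lemma absorb {X : Finset V} {P : V → ℕ} (hP : PropOn G X P) {v : V} :
    ∀ n : ℕ, ∀ Q : V → ℕ, Opt G X Q → v ∈ sing X Q →
      X.card - (X.filter (fun x => ∀ y ∈ X, (P y = P x ↔ Q y = Q x))).card = n →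
      ∃ Q', Opt G X Q' ∧ v ∈ sing X Q' ∧ sing X Q' ⊆ insert v (sing X P) := by
  intro n
  induction n using Nat.strong_induction_on with
  | _ n ih =>
    intro Q hQ hv hn
    by_cases hdone : sing X Q ⊆ insert v (sing X P)
    · exact ⟨Q, hQ, hv, hdone⟩
    rw [Finset.not_subset] at hdone
    obtain ⟨x, hxQ, hx⟩ := hdone
    rw [Finset.mem_insert, not_or] at hx
    obtain ⟨hxv, hxP⟩ := hx
    have hadj := hQ.adj hxQ hv hxv
    have hxQ' := mem_sing.1 hxQ
    have hvQ' := mem_sing.1 hv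
    have hPvx : P v ≠ P x := fun h => hP x hxQ'.1 v hvQ'.1 hadj h.symm
    have hz : ∃ z ∈ X, P z = P x ∧ z ≠ x := by
      by_contra hcon
      push Not at hcon
      exact hxP (mem_sing.2 ⟨hxQ'.1, hcon⟩)
    obtain ⟨z, hzX, hzP, hzx⟩ := hz
    set Q' : V → ℕ := fun y => if P y = P x then Q x else Q y with hQ'
    have e1 : ∀ y, P y = P x → Q' y = Q x := fun y hy => by simp [hQ', hy]
    have e2 : ∀ y, P y ≠ P x → Q' y = Q y := fun y hy => by simp [hQ', hy]
    have e3 : ∀ y ∈ X, P y ≠ P x → Q y ≠ Q x := fun y hy h h' =>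
      h (by rw [hxQ'.2 y hy h'])
    have hopt : Opt G X Q' := by
      constructor
      · intro a ha b hb hab
        by_cases h1 : P a = P x <;> by_cases h2 : P b = P x
        · exact absurd (h1.trans h2.symm) (hP a ha b hb hab)
        · rw [e1 a h1, e2 b h2]; exact (e3 b hb h2).symm
        · rw [e2 a h1, e1 b h2]; exact (e3 a ha h1)
        · rw [e2 a h1, e2 b h2]; exact hQ.1 a ha b hb hab
      · refine le_trans (Finset.card_le_card ?_) hQ.2
        intro k hk
        obtain ⟨y, hy, rfl⟩ := Finset.mem_image.1 hk
        by_cases h1 : P y = P x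
        · rw [e1 y h1]; exact Finset.mem_image_of_mem _ hxQ'.1
        · rw [e2 y h1]; exact Finset.mem_image_of_mem _ hy
    have hsing : v ∈ sing X Q' := by
      refine mem_sing.2 ⟨hvQ'.1, fun y hy hyv => ?_⟩
      rw [e2 v hPvx] at hyv
      by_cases h1 : P y = P x
      · rw [e1 y h1] at hyv
        exact absurd hyv.symm (e3 v hvQ'.1 hPvx)
      · rw [e2 y h1] at hyv
        exact hvQ'.2 y hy hyv
    have hlt : (X.filter (fun x => ∀ y ∈ X, (P y = P x ↔ Q y = Q x))).card <
        (X.filter (fun x => ∀ y ∈ X, (P y = P x ↔ Q' y = Q' x))).card := by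
      apply Finset.card_lt_card
      rw [Finset.ssubset_iff_of_subset]
      · refine ⟨x, ?_, ?_⟩
        · refine Finset.mem_filter.2 ⟨hxQ'.1, fun y hy => ?_⟩
          rw [e1 x rfl]
          constructor
          · exact e1 y
          · intro h
            by_contra h1
            rw [e2 y h1] at h
            exact e3 y hy h1 h
        · intro hmem
          have := (Finset.mem_filter.1 hmem).2 z hzX
          exact hzx (hxQ'.2 z hzX (this.1 hzP))
      · intro w hw
        obtain ⟨hwX, hw⟩ := Finset.mem_filter.1 hw
        have hwx : P w ≠ P x := by
          intro h
          have h1 := (hw x hxQ'.1).1 h.symm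
          have h2 := hxQ'.2 w hwX h1.symm
          subst h2
          exact hzx (hxQ'.2 z hzX ((hw z hzX).1 hzP))
        refine Finset.mem_filter.2 ⟨hwX, fun y hy => ?_⟩
        rw [e2 w hwx]
        by_cases h1 : P y = P x
        · rw [e1 y h1, h1]
          exact ⟨fun h => absurd h.symm hwx, fun h => absurd h.symm (e3 w hwX hwx)⟩
        · rw [e2 y h1]; exact hw y hy
    have hle := Finset.card_filter_le X (fun x => ∀ y ∈ X, (P y = P x ↔ Q' y = Q' x))
    exact ih _ (by omega) Q' hopt hsing rfl

open Classical in
lemma gallai {X : Finset V} (hcrit : ∀ v ∈ X, chi G (X.erase v) < chi G X)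
    (hconn : ∀ S T : Finset V, S.Nonempty → T.Nonempty → Disjoint S T → S ∪ T = X →
      ¬ ∀ a ∈ S, ∀ b ∈ T, G.Adj a b) :
    2 * chi G X ≤ X.card + 1 := by
  -- an optimal colouring with fewest singletons
  have hex : ∃ n, ∃ c, Opt G X c ∧ (sing X c).card = n := by
    obtain ⟨c, hc, hp⟩ := chi_spec (G := G) X
    refine ⟨_, c, ⟨hp, ?_⟩, rfl⟩
    have : X.image c ⊆ Finset.range (chi G X) := by
      intro k hk
      obtain ⟨a, ha, rfl⟩ := Finset.mem_image.1 hk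
      exact Finset.mem_range.2 (hc a ha)
    simpa using Finset.card_le_card this
  obtain ⟨P, hP, hPn⟩ := Nat.find_spec hex
  have hmin : ∀ Q, Opt G X Q → Nat.find hex ≤ (sing X Q).card :=
    fun Q hQ => Nat.find_min' hex ⟨Q, hQ, rfl⟩
  set s0 := Nat.find hex with hs0
  have hstep : ∀ (v : V), v ∈ X → ∀ P, Opt G X P →
      ∃ Q, Opt G X Q ∧ v ∈ sing X Q ∧ sing X Q ⊆ insert v (sing X P) := by
    intro v hv P hP
    obtain ⟨d, hd, hdp⟩ := chi_spec (G := G) (X.erase v)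
    set k := chi G (X.erase v) with hk
    have hkX := hcrit v hv
    have hdlt : ∀ y ∈ X, y ≠ v → d y < k := fun y hy hyv => hd y (Finset.mem_erase.2 ⟨hyv, hy⟩)
    refine absorb hP.1 _ (fun y => if y = v then k else d y) ⟨?_, ?_⟩ ?_ rfl
    · intro x hx y hy hxy
      by_cases hxv : x = v <;> by_cases hyv : y = v
      · subst hxv; subst hyv; exact absurd hxy G.irrefl
      · simp only [hxv, hyv, if_true, if_false]; exact (hdlt y hy hyv).ne'
      · simp only [hxv, hyv, if_true, if_false]; exact (hdlt x hx hxv).ne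
      · simp only [hxv, hyv, if_false]
        exact hdp x (Finset.mem_erase.2 ⟨hxv, hx⟩) y (Finset.mem_erase.2 ⟨hyv, hy⟩) hxy
    · have : X.image (fun y => if y = v then k else d y) ⊆ Finset.range (k + 1) := by
        intro j hj
        obtain ⟨y, hy, rfl⟩ := Finset.mem_image.1 hj
        by_cases hyv : y = v
        · simp [hyv]
        · have := hdlt y hy hyv
          simp only [hyv, if_false, Finset.mem_range]; omega
      have := Finset.card_le_card this
      rw [Finset.card_range] at this
      omega
    · refine mem_sing.2 ⟨hv, fun y hy hyv => ?_⟩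
      by_contra hne
      simp only [hne, if_true, if_false] at hyv
      exact (hdlt y hy hne).ne hyv
  let r : V → V → Prop := fun a b => a ∈ X ∧ b ∈ X ∧ a ≠ b ∧ ¬ G.Adj a b
  have hchain : ∀ w a, Relation.ReflTransGen r a w →
      ∀ P, Opt G X P → (sing X P).card = s0 → a ∈ sing X P → w ∈ sing X P → a = w := by
    intro w a har
    induction har using Relation.ReflTransGen.head_induction_on with
    | refl => intros; rfl
    | head hab hbw ih =>
      rename_i a b
      intro P hP hPc ha hw
      by_contra haw
      obtain ⟨Q, hQ, hbQ, hsub⟩ := hstep b hab.2.1 P hP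
      have haQ : a ∉ sing X Q := fun h => hab.2.2.2 (hQ.adj h hbQ hab.2.2.1)
      have hsub2 : sing X Q ⊆ insert b ((sing X P).erase a) := by
        intro y hy
        have := hsub hy
        rw [Finset.mem_insert] at this ⊢
        rcases this with h | h
        · exact Or.inl h
        · exact Or.inr (Finset.mem_erase.2 ⟨fun h' => haQ (h' ▸ hy), h⟩)
      have hc1 : (insert b ((sing X P).erase a)).card ≤ s0 := by
        refine (Finset.card_insert_le _ _).trans ?_
        rw [Finset.card_erase_of_mem ha]
        have := Finset.card_pos.2 ⟨a, ha⟩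
        omega
      have heq := Finset.eq_of_subset_of_card_le hsub2 (hc1.trans (hmin Q hQ))
      have hwQ : w ∈ sing X Q := by
        rw [heq]
        exact Finset.mem_insert_of_mem (Finset.mem_erase.2 ⟨fun h => haw h.symm, hw⟩)
      have hcQ : (sing X Q).card = s0 := le_antisymm ((Finset.card_le_card hsub2).trans hc1) (hmin Q hQ)
      have hbw' := ih Q hQ hcQ hbQ hwQ
      subst hbw'
      exact hab.2.2.2 (hP.adj ha hw hab.2.2.1)
  have hle1 : s0 ≤ 1 := by
    by_contra hgt
    rw [← hPn] at hgt
    obtain ⟨u, hu, w, hw, huw⟩ := Finset.one_lt_card.1 (not_le.1 hgt)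
    refine huw (hchain w u ?_ P hP hPn hu hw)
    by_contra hnr
    have huX := (mem_sing.1 hu).1
    have hwX := (mem_sing.1 hw).1
    refine hconn (X.filter (fun y => Relation.ReflTransGen r u y))
      (X.filter (fun y => ¬ Relation.ReflTransGen r u y))
      ⟨u, Finset.mem_filter.2 ⟨huX, Relation.ReflTransGen.refl⟩⟩
      ⟨w, Finset.mem_filter.2 ⟨hwX, hnr⟩⟩
      (Finset.disjoint_filter_filter_not _ _ _)
      (Finset.filter_union_filter_not_eq _ _) ?_
    intro a ha b hb
    rw [Finset.mem_filter] at ha hb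
    by_contra hna
    exact hb.2 (ha.2.tail ⟨ha.1, hb.1, fun h => hb.2 (h ▸ ha.2), hna⟩)
  -- counting
  have himg := chi_le_image hP.1
  have hcount : 2 * (X.image P).card ≤ X.card + (sing X P).card := by
    have h1 : X.card = ∑ k ∈ X.image P, (X.filter (fun x => P x = k)).card :=
      Finset.card_eq_sum_card_image P X
    have h2 : (sing X P).card = ∑ k ∈ X.image P, ((sing X P).filter (fun x => P x = k)).card :=
      Finset.card_eq_sum_card_fiberwise (fun x hx =>
        Finset.mem_image_of_mem P (mem_sing.1 hx).1)
    rw [h1, h2, ← Finset.sum_add_distrib, mul_comm, ← smul_eq_mul, ← Finset.sum_const]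
    refine Finset.sum_le_sum fun k hk => ?_
    obtain ⟨x, hx, rfl⟩ := Finset.mem_image.1 hk
    by_cases hxs : x ∈ sing X P
    · have a1 : 0 < (X.filter (fun y => P y = P x)).card :=
        Finset.card_pos.2 ⟨x, by simp [hx]⟩
      have a2 : 0 < ((sing X P).filter (fun y => P y = P x)).card :=
        Finset.card_pos.2 ⟨x, by simp [hxs]⟩
      omega
    · have : ∃ y ∈ X, P y = P x ∧ y ≠ x := by
        by_contra hcon
        push Not at hcon
        exact hxs (mem_sing.2 ⟨hx, hcon⟩)
      obtain ⟨y, hy, hyP, hyx⟩ := this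
      have : 1 < (X.filter (fun y => P y = P x)).card :=
        Finset.one_lt_card.2 ⟨y, by simp [hy, hyP], x, by simp [hx], hyx⟩
      omega
  omega

/-! ### Reduction to the critical, co-connected case -/

open Classical in
noncomputable def nb (G : SimpleGraph V) (X : Finset V) (v : V) : Finset V :=
  X.filter (fun y => G.Adj v y)

lemma mem_nb {X : Finset V} {v y : V} : y ∈ nb G X v ↔ y ∈ X ∧ G.Adj v y := by
  classical
  simp [nb]

open Classical in
lemma reduction (α β d : ℕ)
    (base : ∀ X : Finset V, (∀ v ∈ X, chi G (X.erase v) < chi G X) →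
      2 * chi G X ≤ X.card + 1 → β * X.card < α * chi G X →
      ∃ v ∈ X, chi G X ≤ chi G (insert v (nb G X v)) + d) :
    ∀ n : ℕ, ∀ X : Finset V, X.card = n → β * X.card < α * chi G X →
      ∃ v ∈ X, chi G X ≤ chi G (insert v (nb G X v)) + d := by
  intro n
  induction n using Nat.strong_induction_on with
  | _ n ih =>
    intro X hXn hlt
    by_cases hcrit : ∀ v ∈ X, chi G (X.erase v) < chi G X
    · by_cases hconn : ∀ S T : Finset V, S.Nonempty → T.Nonempty → Disjoint S T → S ∪ T = X →
        ¬ ∀ a ∈ S, ∀ b ∈ T, G.Adj a b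
      · exact base X hcrit (gallai hcrit hconn) hlt
      · push Not at hconn
        obtain ⟨S, T, hS, hT, hST, rfl, hadj⟩ := hconn
        -- symmetric helper
        have key : ∀ S T : Finset V, T.Nonempty → Disjoint S T → (S ∪ T).card = n →
            (∀ a ∈ S, ∀ b ∈ T, G.Adj a b) → β * S.card < α * chi G S →
            ∃ v ∈ S ∪ T, chi G (S ∪ T) ≤ chi G (insert v (nb G (S ∪ T) v)) + d := by
          intro S T hT hST hn hadj hl
          have hTc := Finset.card_pos.2 hT
          rw [Finset.card_union_of_disjoint hST] at hn
          obtain ⟨v, hv, hle⟩ := ih S.card (by omega) S rfl hl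
          refine ⟨v, Finset.mem_union_left _ hv, ?_⟩
          have h1 := chi_union (G := G) S T
          have h2 : chi G (insert v (nb G S v)) + chi G T ≤
              chi G (insert v (nb G S v) ∪ T) := by
            apply chi_join
            intro a ha b hb
            rcases Finset.mem_insert.1 ha with rfl | ha
            · exact hadj _ hv b hb
            · exact hadj a (mem_nb.1 ha).1 b hb
          have h3 : chi G (insert v (nb G S v) ∪ T) ≤ chi G (insert v (nb G (S ∪ T) v)) := by
            apply chi_mono
            intro y hy
            rw [Finset.mem_union, Finset.mem_insert, mem_nb] at hy
            rw [Finset.mem_insert, mem_nb, Finset.mem_union]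
            rcases hy with (h | h) | h
            · exact Or.inl h
            · exact Or.inr ⟨Or.inl h.1, h.2⟩
            · exact Or.inr ⟨Or.inr h, hadj v hv y h⟩
          omega
        have hu := chi_union (G := G) S T
        have hc := Finset.card_union_of_disjoint hST
        by_cases hl : β * S.card < α * chi G S
        · exact key S T hT hST hXn hadj hl
        · have hl2 : β * T.card < α * chi G T := by
            have := Nat.mul_le_mul_left α hu
            rw [hc] at hlt
            rw [mul_add] at hlt this
            omega
          have := key T S hS hST.symm (by rw [Finset.union_comm]; exact hXn)
            (fun a ha b hb => (hadj b hb a ha).symm) hl2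
          rwa [Finset.union_comm T S] at this
    · push Not at hcrit
      obtain ⟨x, hx, hxc⟩ := hcrit
      have h0 := Finset.card_erase_of_mem hx
      have h1 := Finset.card_pos.2 ⟨x, hx⟩
      obtain ⟨v, hv, hle⟩ := ih (X.erase x).card (by omega) (X.erase x) rfl
        (lt_of_le_of_lt (Nat.mul_le_mul_left β (by omega))
          (lt_of_lt_of_le hlt (Nat.mul_le_mul_left α hxc)))
      refine ⟨v, Finset.mem_of_mem_erase hv, ?_⟩
      have h3 : chi G (insert v (nb G (X.erase x) v)) ≤ chi G (insert v (nb G X v)) := by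
        apply chi_mono
        apply Finset.insert_subset_insert
        intro y hy
        rw [mem_nb] at hy ⊢
        exact ⟨Finset.mem_of_mem_erase hy.1, hy.2⟩
      omega

open Classical in
lemma exists_one {X : Finset V} (h : 1 ≤ chi G X) :
    ∃ v ∈ X, 1 ≤ chi G (insert v (nb G X v)) := by
  have : X.Nonempty := by
    by_contra hne
    rw [Finset.not_nonempty_iff_eq_empty] at hne
    subst hne
    rw [chi_empty] at h
    omega
  obtain ⟨v, hv⟩ := this
  exact ⟨v, hv, chi_pos ⟨v, Finset.mem_insert_self _ _⟩⟩

open Classical in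
lemma exists_two {X : Finset V} (h : 2 ≤ chi G X) :
    ∃ v ∈ X, 2 ≤ chi G (insert v (nb G X v)) := by
  have : ∃ a ∈ X, ∃ b ∈ X, G.Adj a b := by
    by_contra hcon
    push Not at hcon
    have := chi_indep hcon
    omega
  obtain ⟨a, ha, b, hb, hab⟩ := this
  refine ⟨a, ha, ?_⟩
  have h1 : ({a, b} : Finset V) ⊆ insert a (nb G X a) := by
    intro y hy
    simp only [Finset.mem_insert, Finset.mem_singleton] at hy
    rcases hy with rfl | rfl
    · exact Finset.mem_insert_self _ _
    · exact Finset.mem_insert_of_mem (mem_nb.2 ⟨hb, hab⟩)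
  have h2 := chi_clique (G := G) (K := {a, b}) (by
    intro x hx y hy hxy
    simp only [Finset.mem_insert, Finset.mem_singleton] at hx hy
    rcases hx with rfl | rfl <;> rcases hy with rfl | rfl
    · exact absurd rfl hxy
    · exact hab
    · exact hab.symm
    · exact absurd rfl hxy)
  rw [Finset.card_pair hab.ne] at h2
  exact h2.trans (chi_mono h1)

open Classical in
lemma lemA (X : Finset V) (h : 3 * X.card < 5 * chi G X) :
    ∃ v ∈ X, chi G X ≤ chi G (insert v (nb G X v)) := by
  have := reduction (G := G) 5 3 0 ?_ X.card X rfl h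
  · simpa using this
  intro X _ hg hlt
  simp only [add_zero]
  have h1 : chi G X = 1 ∨ chi G X = 2 := by omega
  rcases h1 with h1 | h1 <;> rw [h1]
  · exact exists_one h1.ge
  · exact exists_two h1.ge

open Classical in
lemma chi_insert_nb (X : Finset V) (v : V) :
    chi G (nb G X v) + 1 ≤ chi G (insert v (nb G X v)) := by
  have h1 := chi_join (G := G) (S := {v}) (T := nb G X v) (by
    intro a ha b hb
    rw [Finset.mem_singleton] at ha
    subst ha
    exact (mem_nb.1 hb).2)
  have h2 : 1 ≤ chi G ({v} : Finset V) := chi_pos ⟨v, by simp⟩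
  rw [← Finset.insert_eq] at h1
  omega

open Classical in
/-- The non-neighbours of `v` in `X`, other than `v` itself. -/
noncomputable def nn (G : SimpleGraph V) (X : Finset V) (v : V) : Finset V :=
  X.filter (fun y => y ≠ v ∧ ¬ G.Adj v y)

lemma mem_nn {X : Finset V} {v y : V} : y ∈ nn G X v ↔ y ∈ X ∧ y ≠ v ∧ ¬ G.Adj v y := by
  classical
  simp [nn]

lemma chi_nn (X : Finset V) (v : V) : chi G X ≤ chi G (nb G X v) + max 1 (chi G (nn G X v)) := by
  classical
  have h1 : X ⊆ nb G X v ∪ insert v (nn G X v) := by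
    intro y hy
    rw [Finset.mem_union, Finset.mem_insert, mem_nb, mem_nn]
    tauto
  have h2 := chi_mono (G := G) h1
  have h3 := chi_union (G := G) (nb G X v) (insert v (nn G X v))
  have h4 := chi_insert_isolated (G := G) (v := v) (R := nn G X v) (fun a ha => (mem_nn.1 ha).2.2)
  omega

lemma card_nb_nn {X : Finset V} {v : V} (hv : v ∈ X) :
    (nb G X v).card + (nn G X v).card + 1 = X.card := by
  classical
  have h : X = insert v (nb G X v ∪ nn G X v) := by
    ext y
    rw [Finset.mem_insert, Finset.mem_union, mem_nb, mem_nn]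
    constructor
    · tauto
    · rintro (rfl | h | h)
      · exact hv
      · exact h.1
      · exact h.1
  have h1 : v ∉ nb G X v ∪ nn G X v := by
    rw [Finset.mem_union, mem_nb, mem_nn]
    rintro (h | h)
    · exact G.irrefl h.2
    · exact h.2.1 rfl
  have h2 : Disjoint (nb G X v) (nn G X v) := by
    rw [Finset.disjoint_left]
    intro y hy hy'
    exact (mem_nn.1 hy').2.2 (mem_nb.1 hy).2
  conv_rhs => rw [h, Finset.card_insert_of_notMem h1, Finset.card_union_of_disjoint h2]

open Classical in
lemma mindeg {X : Finset V} {v : V} (hv : v ∈ X) (hcrit : chi G (X.erase v) < chi G X) :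
    chi G X ≤ (nb G X v).card + 1 := by
  obtain ⟨c, hc, hp⟩ := chi_spec (G := G) (X.erase v)
  by_contra hlt
  have h1 : ((nb G X v).image c).card < (Finset.range (chi G X - 1)).card := by
    have := Finset.card_image_le (s := nb G X v) (f := c)
    rw [Finset.card_range]
    omega
  obtain ⟨k, hk, hk'⟩ := Finset.exists_mem_notMem_of_card_lt_card h1
  rw [Finset.mem_range] at hk
  have hk'' : ∀ y ∈ X, G.Adj v y → c y ≠ k := fun y hy hvy h =>
    hk' (Finset.mem_image.2 ⟨y, mem_nb.2 ⟨hy, hvy⟩, h⟩)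
  have : Col G X (chi G X - 1) := by
    refine ⟨fun y => if y = v then k else c y, ?_, ?_⟩
    · intro y hy
      by_cases hyv : y = v
      · simp only [hyv, if_true]; exact hk
      · simp only [hyv, if_false]
        have := hc y (Finset.mem_erase.2 ⟨hyv, hy⟩)
        omega
    · intro x hx y hy hxy
      by_cases hxv : x = v <;> by_cases hyv : y = v
      · subst hxv; subst hyv; exact absurd hxy G.irrefl
      · simp only [hxv, hyv, if_true, if_false]; subst hxv; exact (hk'' y hy hxy).symm
      · simp only [hxv, hyv, if_true, if_false]; subst hyv; exact (hk'' x hx hxy.symm)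
      · simp only [hxv, hyv, if_false]
        exact hp x (Finset.mem_erase.2 ⟨hxv, hx⟩) y (Finset.mem_erase.2 ⟨hyv, hy⟩) hxy
  have := chi_le this
  omega

open Classical in
lemma handshake (X : Finset V) (h : ∀ v ∈ X, (nb G X v).card = 5) : X.card ≠ 9 := by
  intro h9
  have hdeg : ∀ v : X, (G.induce (X : Set V)).degree v = 5 := by
    intro v
    rw [← h v.1 v.2, ← SimpleGraph.card_neighborFinset_eq_degree]
    refine Finset.card_bij (fun a _ => a.1) ?_ ?_ ?_
    · intro a ha
      rw [SimpleGraph.mem_neighborFinset] at ha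
      exact mem_nb.2 ⟨a.2, ha⟩
    · intro a _ b _ hab
      exact Subtype.ext hab
    · intro b hb
      rw [mem_nb] at hb
      exact ⟨⟨b, hb.1⟩, by rw [SimpleGraph.mem_neighborFinset]; exact hb.2, rfl⟩
  have h1 := (G.induce (X : Set V)).sum_degrees_eq_twice_card_edges
  have h2 : ∑ v : (X : Set V), (G.induce (X : Set V)).degree v = ∑ v : (X : Set V), 5 :=
    Finset.sum_congr rfl (fun v _ => hdeg v)
  rw [h2] at h1
  simp only [Finset.sum_const, Finset.card_univ, smul_eq_mul] at h1
  have h3 : Fintype.card (X : Set V) = 9 := by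
    simpa using h9
  omega

open Classical in
lemma lemB (X : Finset V) (h : 6 * X.card < 11 * chi G X) :
    ∃ v ∈ X, chi G X ≤ chi G (insert v (nb G X v)) + 1 := by
  refine reduction (G := G) 11 6 1 ?_ X.card X rfl h
  clear h X
  intro X hcrit hg hlt
  have hmono : ∀ Y ⊆ X, ∀ v, chi G (insert v (nb G Y v)) ≤ chi G (insert v (nb G X v)) := by
    intro Y hY v
    apply chi_mono
    apply Finset.insert_subset_insert
    intro y hy
    rw [mem_nb] at hy ⊢
    exact ⟨hY hy.1, hy.2⟩
  have hnnX : ∀ v, nn G X v ⊆ X := fun v y hy => (mem_nn.1 hy).1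
  have h1 : chi G X = 1 ∨ chi G X = 2 ∨ chi G X = 3 ∨ chi G X = 4 ∨ chi G X = 5 := by omega
  rcases h1 with h1 | h1 | h1 | h1 | h1
  · obtain ⟨v, hv, h2⟩ := exists_one h1.ge
    exact ⟨v, hv, by omega⟩
  · obtain ⟨v, hv, h2⟩ := exists_two h1.ge
    exact ⟨v, hv, by omega⟩
  · obtain ⟨v, hv, h2⟩ := exists_two (G := G) (X := X) (by omega)
    exact ⟨v, hv, by omega⟩
  · by_contra hcon
    push Not at hcon
    obtain ⟨v, hv, -⟩ := exists_one (G := G) (X := X) (by omega)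
    have h2 := hcon v hv
    have h3 := chi_insert_nb (G := G) X v
    have h4 := chi_nn (G := G) X v
    have h5 := card_nb_nn (G := G) hv
    have h6 := mindeg hv (hcrit v hv)
    have h7 : 3 ≤ chi G (nn G X v) := by omega
    obtain ⟨w, hw, h8⟩ := lemA (G := G) (nn G X v) (by omega)
    have h9 := hcon w (hnnX v hw)
    have h10 := hmono _ (hnnX v) w
    omega
  · by_contra hcon
    push Not at hcon
    have hX9 : X.card = 9 := by omega
    have hcl : ∀ v ∈ X, (nn G X v).card = 3 := by
      intro v hv
      have h2 := hcon v hv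
      have h3 := chi_insert_nb (G := G) X v
      have h4 := chi_nn (G := G) X v
      have h7 : 3 ≤ chi G (nn G X v) := by omega
      have h8 := chi_le_card (G := G) (nn G X v)
      have hK : ∀ a ∈ nn G X v, ∀ b ∈ nn G X v, a ≠ b → G.Adj a b := by
        intro a ha b hb hab
        by_contra hna
        have ha' := mem_nn.1 ha
        have hb' := mem_nn.1 hb
        have hI : chi G ({v, a, b} : Finset V) ≤ 1 := by
          apply chi_indep
          intro x hx y hy hxy
          simp only [Finset.mem_insert, Finset.mem_singleton] at hx hy
          rcases hx with rfl | rfl | rfl <;> rcases hy with rfl | rfl | rfl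
          · exact G.irrefl hxy
          · exact ha'.2.2 hxy
          · exact hb'.2.2 hxy
          · exact ha'.2.2 hxy.symm
          · exact G.irrefl hxy
          · exact hna hxy
          · exact hb'.2.2 hxy.symm
          · exact hna hxy.symm
          · exact G.irrefl hxy
        have hIX : ({v, a, b} : Finset V) ⊆ X := by
          intro x hx
          simp only [Finset.mem_insert, Finset.mem_singleton] at hx
          rcases hx with rfl | rfl | rfl
          · exact hv
          · exact ha'.1
          · exact hb'.1
        have hIc : ({v, a, b} : Finset V).card = 3 :=
          Finset.card_eq_three.2 ⟨v, a, b, ha'.2.1.symm, hb'.2.1.symm, hab, rfl⟩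
        have hu := chi_union (G := G) ({v, a, b} : Finset V) (X \ {v, a, b})
        rw [Finset.union_sdiff_of_subset hIX] at hu
        have hc := Finset.card_sdiff_of_subset hIX
        obtain ⟨w, hw, h9⟩ := lemA (G := G) (X \ {v, a, b}) (by omega)
        have h10 := hcon w (Finset.mem_sdiff.1 hw).1
        have h11 := hmono _ (Finset.sdiff_subset : X \ {v, a, b} ⊆ X) w
        omega
      have h9 := chi_clique hK
      obtain ⟨w, hw⟩ : (nn G X v).Nonempty := Finset.card_pos.1 (by omega)
      have h10 := hcon w (hnnX v hw)
      have h11 : nn G X v ⊆ insert w (nb G X w) := by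
        intro y hy
        rw [Finset.mem_insert, mem_nb]
        by_cases hyw : y = w
        · exact Or.inl hyw
        · exact Or.inr ⟨hnnX v hy, hK w hw y hy (Ne.symm hyw)⟩
      have h12 := chi_mono (G := G) h11
      omega
    refine handshake (G := G) X (fun v hv => ?_) hX9
    have := card_nb_nn (G := G) hv
    have := hcl v hv
    omega

/-! ### Link with the frozen definitions -/

lemma colorable_iff (X : Finset V) (n : ℕ) :
    (G.induce (X : Set V)).Colorable n ↔ Col G X n := by
  classical
  constructor
  · rintro ⟨C⟩
    refine ⟨fun x => if hx : x ∈ X then (C ⟨x, hx⟩ : ℕ) else 0, ?_, ?_⟩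
    · intro x hx
      simp only [hx, dif_pos]
      exact (C ⟨x, hx⟩).2
    · intro x hx y hy hxy
      simp only [hx, hy, dif_pos]
      intro h
      have hadj : (G.induce (X : Set V)).Adj ⟨x, hx⟩ ⟨y, hy⟩ := hxy
      exact C.valid hadj (Fin.ext h)
  · rintro ⟨c, hc, hp⟩
    exact ⟨SimpleGraph.Coloring.mk (fun x => (⟨c x.1, hc x.1 x.2⟩ : Fin n)) (by
      intro x y hxy h
      exact hp x.1 x.2 y.1 y.2 hxy (congrArg Fin.val h))⟩

lemma chromNum_induce (X : Finset V) : chromNum (G.induce (X : Set V)) = chi G X := by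
  unfold chromNum chi
  congr 1
  ext n
  exact colorable_iff X n

lemma chromNum_univ [Fintype V] : chromNum G = chi G Finset.univ := by
  rw [← chromNum_induce]
  unfold chromNum
  congr 1
  ext n
  have e : G.induce ((Finset.univ : Finset V) : Set V) ≃g G := by
    rw [Finset.coe_univ]
    exact SimpleGraph.induceUnivIso G
  exact ⟨fun h => h.of_hom e.toHom, fun h => h.of_hom e.symm.toHom⟩

end Helpers

open Classical in
lemma main_cover {V : Type*} [Fintype V] [Nonempty V]
    (s : ℕ) (G : SimpleGraph V)
    (hloc : ∀ v, chi G (insert v (nb G Finset.univ v)) ≤ s)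
    (hchi : 6 * chi G Finset.univ < 11 * s + 16) (σ : V → ℕ) (hσ : IsProperColoring G σ) :
    ∃ X : Finset V, chi G Finset.univ + chi G X ≤ (X.image σ).card + s := by
  have hp : PropOn G Finset.univ σ := fun x _ y _ h => hσ h
  have hle := chi_le_image hp
  rcases hle.eq_or_lt with heq | hlt
  · -- rainbow neighbourhood
    obtain ⟨v0⟩ := ‹Nonempty V›
    by_cases hv : ∃ v, σ v = σ v0 ∧ ∀ k ∈ Finset.univ.image σ,
        k ∈ (insert v (nb G Finset.univ v)).image σ
    · obtain ⟨v, -, hv⟩ := hv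
      refine ⟨insert v (nb G Finset.univ v), ?_⟩
      have h1 := Finset.card_le_card hv
      have h2 := hloc v
      omega
    · exfalso
      push Not at hv
      have hv' : ∀ v, ∃ k, σ v = σ v0 → k ∈ Finset.univ.image σ ∧
          k ∉ (insert v (nb G Finset.univ v)).image σ := by
        intro v
        by_cases h : σ v = σ v0
        · obtain ⟨k, hk⟩ := hv v h
          exact ⟨k, fun _ => hk⟩
        · exact ⟨0, fun h' => absurd h' h⟩
      choose f hf using hv'
      have hf1 : ∀ v, σ v = σ v0 → f v ≠ σ v0 := by
        intro v h h'
        refine (hf v h).2 (Finset.mem_image.2 ⟨v, Finset.mem_insert_self _ _, ?_⟩)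
        rw [h', h]
      have hf2 : ∀ v, σ v = σ v0 → ∀ y, G.Adj v y → σ y ≠ f v := by
        intro v h y hvy h'
        exact (hf v h).2 (Finset.mem_image.2 ⟨y,
          Finset.mem_insert_of_mem (mem_nb.2 ⟨Finset.mem_univ _, hvy⟩), h'⟩)
      have hq : PropOn G Finset.univ (fun y => if σ y = σ v0 then f y else σ y) := by
        intro x _ y _ hxy
        by_cases h1 : σ x = σ v0 <;> by_cases h2 : σ y = σ v0
        · exact absurd (h1.trans h2.symm) (hσ hxy)
        · simp only [h1, h2, if_true, if_false]
          exact (hf2 x h1 y hxy).symm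
        · simp only [h1, h2, if_true, if_false]
          exact (hf2 y h2 x hxy.symm)
        · simp only [h1, h2, if_false]
          exact hσ hxy
      have h1 := chi_le_image hq
      have h2 : Finset.univ.image (fun y => if σ y = σ v0 then f y else σ y) ⊆
          (Finset.univ.image σ).erase (σ v0) := by
        intro k hk
        obtain ⟨y, -, rfl⟩ := Finset.mem_image.1 hk
        by_cases h : σ y = σ v0
        · simp only [h, if_true]
          exact Finset.mem_erase.2 ⟨hf1 y h, (hf y h).1⟩
        · simp only [h, if_false]
          exact Finset.mem_erase.2 ⟨h, Finset.mem_image_of_mem _ (Finset.mem_univ _)⟩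
      have h3 := Finset.card_le_card h2
      have h4 : σ v0 ∈ Finset.univ.image σ := Finset.mem_image_of_mem _ (Finset.mem_univ _)
      rw [Finset.card_erase_of_mem h4] at h3
      have h5 := Finset.card_pos.2 ⟨_, h4⟩
      omega
  · -- transversal
    have hsec : ∀ k, ∃ v, k ∈ Finset.univ.image σ → σ v = k := by
      intro k
      by_cases hk : k ∈ Finset.univ.image σ
      · obtain ⟨v, -, h⟩ := Finset.mem_image.1 hk
        exact ⟨v, fun _ => h⟩
      · exact ⟨Classical.arbitrary V, fun h => absurd h hk⟩
    choose g hg using hsec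
    obtain ⟨X, hXi, hXs⟩ : ∃ X : Finset V, Set.InjOn σ (X : Set V) ∧
        X.image σ = Finset.univ.image σ := by
      refine ⟨(Finset.univ.image σ).image g, ?_, ?_⟩
      · intro a ha b hb hab
        obtain ⟨k, hk, rfl⟩ := Finset.mem_image.1 (Finset.mem_coe.1 ha)
        obtain ⟨l, hl, rfl⟩ := Finset.mem_image.1 (Finset.mem_coe.1 hb)
        rw [hg k hk, hg l hl] at hab
        rw [hab]
      · rw [Finset.image_image]
        exact (Finset.image_congr (fun k hk => hg k hk)).trans Finset.image_id
    have hXc : X.card = (Finset.univ.image σ).card := by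
      rw [← hXs, Finset.card_image_of_injOn hXi]
    refine ⟨X, ?_⟩
    rw [hXs]
    by_contra hcon
    obtain ⟨v, hv, h1⟩ := lemB (G := G) X (by omega)
    have h2 : chi G (insert v (nb G X v)) ≤ chi G (insert v (nb G Finset.univ v)) := by
      apply chi_mono
      apply Finset.insert_subset_insert
      intro y hy
      rw [mem_nb] at hy ⊢
      exact ⟨Finset.mem_univ _, hy.2⟩
    have h3 := hloc v
    omega

/-- For every integer `s ≥ 2`, every finite locally `s`-colourable graph
`G` with at least one vertex and `χ(G) < (11s+16)/6` satisfies `φ(G) ≥ χ(G) - s`. -/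
theorem locallyColourable_chromDisc_smallChi {V : Type*} [Fintype V] [Nonempty V]
    (s : ℕ) (hs : 2 ≤ s) (G : SimpleGraph V) (hloc : LocallyColorable G s)
    (hchi : (chromNum G : ℝ) < (11 * s + 16) / 6) :
    chromDisc G ≥ (chromNum G : ℤ) - s := by
  classical
  have hchi' : 6 * chi G Finset.univ < 11 * s + 16 := by
    rw [← chromNum_univ]
    rw [lt_div_iff₀ (by norm_num)] at hchi
    have : ((6 * chromNum G : ℕ) : ℝ) < ((11 * s + 16 : ℕ) : ℝ) := by
      push_cast
      linarith
    exact_mod_cast this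
  have hloc' : ∀ v, chi G (insert v (nb G Finset.univ v)) ≤ s := by
    intro v
    have h := hloc v
    have he : insert v (G.neighborSet v) =
        ((insert v (nb G Finset.univ v) : Finset V) : Set V) := by
      ext y
      simp [mem_nb]
    rw [he, chromNum_induce] at h
    exact h
  unfold chromDisc
  apply le_csInf
  · obtain ⟨c, hc⟩ := exists_inj (G := G) (Finset.univ : Finset V)
    exact ⟨_, c, fun u v h => hc u (Finset.mem_univ _) v (Finset.mem_univ _) h, rfl⟩
  · rintro z ⟨σ, hσ, rfl⟩
    obtain ⟨X, hX⟩ := main_cover s G hloc' hchi' σ hσ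
    unfold colDisc
    refine le_csSup_of_le ?_ ⟨(X : Set V), rfl⟩ ?_
    · have : {z : ℤ | ∃ S : Set V,
          z = ((σ '' S).ncard : ℤ) - (chromNum (G.induce S) : ℤ)} =
          Set.range (fun S : Set V => ((σ '' S).ncard : ℤ) - (chromNum (G.induce S) : ℤ)) := by
        ext z
        simp [eq_comm]
      rw [this]
      exact (Set.finite_range _).bddAbove
    · rw [chromNum_induce, chromNum_univ, ← Finset.coe_image, Set.ncard_coe_finset]
      omega
end

section
/- For all integers s₁, s₂ ≥ 2 there exists a constant C ≥ 0 such that every finite simple graph G with at least one vertex that is 1-locally s₁-colourable and 2-locally s₂-colourable satisfies φ(G) ≥ χ(G) − 4·s₁·s₂·ln(ln(χ(G))) − C (as an inequality of real numbers, for χ(G) large enough that ln ln χ(G) is defined, or with the convention that the right-hand side is ≤ 0 otherwise). -/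
open SimpleGraph

/-- The set `S` can be properly coloured with `n` colours. -/
def SetCol {V : Type*} (G : SimpleGraph V) (S : Set V) (n : ℕ) : Prop :=
  ∃ f : V → ℕ, (∀ v ∈ S, f v < n) ∧ ∀ u ∈ S, ∀ v ∈ S, G.Adj u v → f u ≠ f v

lemma setCol_iff_colorable {V : Type*} (G : SimpleGraph V) (S : Set V) (n : ℕ) :
    SetCol G S n ↔ (G.induce S).Colorable n := by
  classical
  constructor
  · rintro ⟨f, hf, hp⟩
    refine ⟨SimpleGraph.Coloring.mk (fun v : S => (⟨f v, hf v v.2⟩ : Fin n)) ?_⟩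
    intro u v huv h
    exact hp u u.2 v v.2 huv (by simpa using h)
  · rintro ⟨c⟩
    refine ⟨fun v => if h : v ∈ S then (c ⟨v, h⟩ : ℕ) else 0, ?_, ?_⟩
    · intro v hv
      simp [hv]
    · intro u hu v hv huv h
      simp only [hu, hv, dif_pos] at h
      have : (G.induce S).Adj ⟨u, hu⟩ ⟨v, hv⟩ := huv
      exact c.valid this (Fin.ext h)

lemma setCol_iff {V : Type*} [Fintype V] (G : SimpleGraph V) (S : Set V) (n : ℕ) :
    SetCol G S n ↔ chromNum (G.induce S) ≤ n := by
  classical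
  rw [setCol_iff_colorable]
  constructor
  · intro h
    exact Nat.sInf_le h
  · intro h
    have hne : {n : ℕ | (G.induce S).Colorable n}.Nonempty :=
      ⟨_, (G.induce S).colorable_of_fintype⟩
    exact (show (G.induce S).Colorable _ from Nat.sInf_mem hne).mono h

lemma SetCol.mono {V : Type*} {G : SimpleGraph V} {S T : Set V} {m n : ℕ}
    (h : SetCol G T n) (hST : S ⊆ T) (hnm : n ≤ m) : SetCol G S m := by
  obtain ⟨f, hf, hp⟩ := h
  exact ⟨f, fun v hv => (hf v (hST hv)).trans_le hnm,
    fun u hu v hv => hp u (hST hu) v (hST hv)⟩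

lemma SetCol.union {V : Type*} {G : SimpleGraph V} {S T : Set V} {m n : ℕ}
    (hS : SetCol G S m) (hT : SetCol G T n) : SetCol G (S ∪ T) (m + n) := by
  classical
  obtain ⟨f, hf, hfp⟩ := hS
  obtain ⟨g, hg, hgp⟩ := hT
  refine ⟨fun v => if v ∈ S then f v else m + g v, ?_, ?_⟩
  · intro v hv
    by_cases h : v ∈ S
    · have := hf v h
      simp only [h, if_true]; omega
    · have := hg v (hv.resolve_left h)
      simp only [h, if_false]; omega
  · intro u hu v hv huv
    by_cases h1 : u ∈ S <;> by_cases h2 : v ∈ S <;> simp only [h1, h2, if_true, if_false]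
    · exact hfp u h1 v h2 huv
    · have := hf u h1; omega
    · have := hf v h2; omega
    · have := hgp u (hu.resolve_left h1) v (hv.resolve_left h2) huv
      omega

/-- Union of two sets with no edges between them. -/
lemma SetCol.union_disj {V : Type*} {G : SimpleGraph V} {S T : Set V} {n : ℕ}
    (hS : SetCol G S n) (hT : SetCol G T n) (hd : ∀ v ∈ T, v ∉ S)
    (hna : ∀ u ∈ S, ∀ v ∈ T, ¬ G.Adj u v) : SetCol G (S ∪ T) n := by
  classical
  obtain ⟨f, hf, hfp⟩ := hS
  obtain ⟨g, hg, hgp⟩ := hT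
  refine ⟨fun v => if v ∈ S then f v else g v, ?_, ?_⟩
  · intro v hv
    by_cases h : v ∈ S
    · simpa only [h, if_true] using hf v h
    · simpa only [h, if_false] using hg v (hv.resolve_left h)
  · intro u hu v hv huv
    by_cases h1 : u ∈ S <;> by_cases h2 : v ∈ S <;> simp only [h1, h2, if_true, if_false]
    · exact hfp u h1 v h2 huv
    · exact absurd huv (hna u h1 v (hv.resolve_left h2))
    · exact absurd huv.symm (hna v h2 u (hu.resolve_left h1))
    · exact hgp u (hu.resolve_left h1) v (hv.resolve_left h2) huv

/-- Evaluation of a quadratic polynomial given by its coefficients. -/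
def quadEval {q : ℕ} (t : ZMod q × ZMod q × ZMod q) (x : ZMod q) : ZMod q :=
  t.2.2 * x ^ 2 + t.2.1 * x + t.1

open Polynomial in
lemma quadEval_agree {q : ℕ} [Fact q.Prime] (t t' : ZMod q × ZMod q × ZMod q) (h : t ≠ t') :
    (Finset.univ.filter (fun x : ZMod q => quadEval t x = quadEval t' x)).card ≤ 2 := by
  classical
  set P : (ZMod q)[X] := C (t.2.2 - t'.2.2) * X ^ 2 + C (t.2.1 - t'.2.1) * X + C (t.1 - t'.1)
    with hP
  have hP0 : P ≠ 0 := by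
    intro h0
    apply h
    have h2 : P.coeff 2 = 0 := by rw [h0]; simp
    have h1 : P.coeff 1 = 0 := by rw [h0]; simp
    have h3 : P.coeff 0 = 0 := by rw [h0]; simp
    rw [hP] at h1 h2 h3
    simp only [coeff_add, coeff_C_mul, coeff_X_pow, coeff_X, coeff_C] at h1 h2 h3
    norm_num at h1 h2 h3
    exact Prod.ext (sub_eq_zero.1 h3) (Prod.ext (sub_eq_zero.1 h1) (sub_eq_zero.1 h2))
  calc _ ≤ P.roots.toFinset.card := by
        apply Finset.card_le_card
        intro x hx
        have hx := (Finset.mem_filter.1 hx).2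
        unfold quadEval at hx
        rw [Multiset.mem_toFinset, mem_roots hP0, IsRoot.def, hP]
        simp only [eval_add, eval_mul, eval_C, eval_pow, eval_X]
        linear_combination hx
    _ ≤ P.roots.card := Multiset.toFinset_card_le _
    _ ≤ P.natDegree := card_roots' P
    _ ≤ 2 := natDegree_quadratic_le

/-- If every vertex sees few colours, the chromatic number is small. -/
lemma setCol_of_sees_few {V : Type*} [Fintype V] (G : SimpleGraph V) (σ : V → ℕ)
    (hσ : IsProperColoring G σ) (W : Set V) (d q : ℕ) (hq : q.Prime) (hdq : 2 * d ≤ q)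
    (hW : (σ '' W).ncard ≤ q ^ 3)
    (hsee : ∀ v, (σ '' (G.neighborSet v ∩ W)).ncard < d) : SetCol G W (q * q) := by
  classical
  have : Fact q.Prime := ⟨hq⟩
  -- an injection of the colours into the quadratic polynomials
  obtain ⟨e, he⟩ : ∃ e : ℕ → ZMod q × ZMod q × ZMod q, Set.InjOn e (σ '' W) := by
    have hfin : (σ '' W).Finite := Set.toFinite _
    have hcard : Fintype.card hfin.toFinset ≤
        Fintype.card (ZMod q × ZMod q × ZMod q) := by
      rw [Fintype.card_coe, ← Set.ncard_eq_toFinset_card _ hfin]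
      simp only [Fintype.card_prod, ZMod.card]
      calc _ ≤ q ^ 3 := hW
        _ = _ := by ring
    obtain ⟨e⟩ := Function.Embedding.nonempty_of_card_le hcard
    refine ⟨fun c => if h : c ∈ hfin.toFinset then e ⟨c, h⟩ else 0, ?_⟩
    intro c hc c' hc' h
    have h1 : c ∈ hfin.toFinset := hfin.mem_toFinset.2 hc
    have h2 : c' ∈ hfin.toFinset := hfin.mem_toFinset.2 hc'
    simp only [h1, h2, dif_pos] at h
    exact Subtype.mk.inj (e.injective h)
  have key : ∀ v ∈ W, ∃ x : ZMod q, ∀ u ∈ W, G.Adj v u →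
      quadEval (e (σ u)) x ≠ quadEval (e (σ v)) x := by
    intro v hv
    have hfin : (σ '' (G.neighborSet v ∩ W)).Finite := Set.toFinite _
    set F := hfin.toFinset with hF
    have hFc : F.card < d := by
      rw [hF, ← Set.ncard_eq_toFinset_card _ hfin]; exact hsee v
    set B : Finset (ZMod q) := F.biUnion (fun c => Finset.univ.filter
      (fun x : ZMod q => quadEval (e c) x = quadEval (e (σ v)) x)) with hB
    have hBc : B.card ≤ F.card * 2 := by
      apply Finset.card_biUnion_le_card_mul
      intro c hc
      rw [hF, Set.Finite.mem_toFinset] at hc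
      obtain ⟨u, ⟨hu1, hu2⟩, rfl⟩ := hc
      apply quadEval_agree
      intro h
      exact hσ hu1 (he ⟨u, hu2, rfl⟩ ⟨v, hv, rfl⟩ h).symm
    have hlt : B.card < (Finset.univ : Finset (ZMod q)).card := by
      rw [Finset.card_univ, ZMod.card]; omega
    obtain ⟨x, -, hx⟩ := Finset.exists_mem_notMem_of_card_lt_card hlt
    refine ⟨x, fun u hu huv h => hx ?_⟩
    rw [hB, Finset.mem_biUnion]
    exact ⟨σ u, by rw [hF, Set.Finite.mem_toFinset]; exact ⟨u, ⟨huv, hu⟩, rfl⟩, by simp [h]⟩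
  choose! x hx using key
  have hcard : Fintype.card (ZMod q × ZMod q) = q * q := by simp [ZMod.card]
  let ι := Fintype.equivFinOfCardEq hcard
  refine ⟨fun v => (ι (x v, quadEval (e (σ v)) (x v)) : ℕ), fun v _ => (ι _).2, ?_⟩
  intro u hu v hv huv h
  have h2 := ι.injective (Fin.ext h)
  rw [Prod.mk.injEq] at h2
  apply hx v hv u hu huv.symm
  rw [← h2.2, h2.1]

/-- One step: the colours of `Y` are covered cheaply, the rest has small chromatic number. -/
lemma one_step {V : Type*} [Fintype V] (G : SimpleGraph V) (σ : V → ℕ)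
    (hσ : IsProperColoring G σ) (s₁ s₂ : ℕ)
    (h1 : ∀ v, SetCol G (ballSet G v 1) s₁) (h2 : ∀ v, SetCol G (ballSet G v 2) s₂)
    (S : Set V) (d q : ℕ) (hd : 0 < d) (hq : q.Prime) (hdq : 2 * d ≤ q)
    (hW : (σ '' S).ncard ≤ q ^ 3) :
    ∃ (Y : Set V) (j : ℕ), Y ⊆ S ∧ j * d ≤ (σ '' S).ncard ∧ SetCol G Y s₁ ∧
      SetCol G {v | v ∈ S ∧ σ v ∉ σ '' Y} (s₂ * j + q * q) := by
  classical
  let Good : ℕ → Prop := fun j => ∃ Y : Set V, Y ⊆ S ∧ j * d ≤ (σ '' Y).ncard ∧ SetCol G Y s₁ ∧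
    SetCol G (closedNbhd G Y) (s₂ * j)
  have hG0 : Good 0 := by
    refine ⟨∅, by simp, by simp, ⟨fun _ => 0, by simp, by simp⟩, ⟨fun _ => 0, ?_, ?_⟩⟩ <;>
    simp [closedNbhd]
  have hbd : ∀ j, Good j → j ≤ (σ '' S).ncard := by
    rintro j ⟨Y, hY, hj, -⟩
    have : (σ '' Y).ncard ≤ (σ '' S).ncard :=
      Set.ncard_le_ncard (Set.image_mono hY) (Set.toFinite _)
    nlinarith
  set j := Nat.findGreatest Good (σ '' S).ncard with hj
  have hjG : Good j := Nat.findGreatest_spec (Nat.zero_le _) hG0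
  have hmax : ¬ Good (j + 1) := by
    intro h
    have := Nat.le_findGreatest (hbd _ h) h
    omega
  obtain ⟨Y, hYS, hYj, hY1, hY2⟩ := hjG
  refine ⟨Y, j, hYS, hYj.trans
    (Set.ncard_le_ncard (Set.image_mono hYS) (Set.toFinite _)), hY1, ?_⟩
  set W : Set V := {v | v ∈ S ∧ σ v ∉ σ '' Y ∧ v ∉ closedNbhd G Y} with hWdef
  have hWS : W ⊆ S := fun v hv => hv.1
  have hsee : ∀ v, (σ '' (G.neighborSet v ∩ W)).ncard < d := by
    intro v
    by_contra hcon
    push Not at hcon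
    apply hmax
    set Z := G.neighborSet v ∩ W with hZ
    refine ⟨Y ∪ Z, Set.union_subset hYS (fun u hu => hWS hu.2), ?_, ?_, ?_⟩
    · rw [Set.image_union, Set.ncard_union_eq ?_ (Set.toFinite _) (Set.toFinite _)]
      · rw [add_mul, one_mul]; omega
      · rw [Set.disjoint_right]
        rintro c ⟨u, hu, rfl⟩
        exact hu.2.2.1
    · apply SetCol.union_disj hY1
      · apply (h1 v).mono _ le_rfl
        rintro u ⟨hu, -⟩
        have hu' : G.Adj v u := hu
        exact ⟨SimpleGraph.Walk.cons hu' SimpleGraph.Walk.nil, by simp⟩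
      · intro u hu hY
        exact hu.2.2.2 (Or.inl hY)
      · intro y hy z hz hyz
        exact hz.2.2.2 (Or.inr ⟨y, hy, hyz⟩)
    · have := hY2.union (h2 v)
      apply this.mono _ (by rw [mul_add, mul_one])
      rintro u ((hu | hu) | ⟨w, hw | hw, hwu⟩)
      · exact Or.inl (Or.inl hu)
      · have hu' : G.Adj v u := hu.1
        exact Or.inr ⟨SimpleGraph.Walk.cons hu' SimpleGraph.Walk.nil, by simp⟩
      · exact Or.inl (Or.inr ⟨w, hw, hwu⟩)
      · have hw' : G.Adj v w := hw.1
        exact Or.inr ⟨SimpleGraph.Walk.cons hw'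
          (SimpleGraph.Walk.cons hwu SimpleGraph.Walk.nil), by simp⟩
  have hWc := setCol_of_sees_few G σ hσ W d q hq hdq
    ((Set.ncard_le_ncard (Set.image_mono hWS) (Set.toFinite _)).trans hW) hsee
  apply (hY2.union hWc).mono _ le_rfl
  rintro v ⟨hv, hv2⟩
  by_cases h : v ∈ closedNbhd G Y
  · exact Or.inl h
  · exact Or.inr ⟨hv, hv2, h⟩

/-- Choice of parameters. -/
lemma exists_params (n : ℕ) (hn : 1 ≤ n) :
    ∃ k : ℕ, 0 < k ∧ 2 * n ≤ k ^ 3 ∧ k ^ 3 ≤ 16 * n := by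
  classical
  have hex : ∃ k : ℕ, 2 * n ≤ k ^ 3 := ⟨2 * n, Nat.le_self_pow (by norm_num) _⟩
  have hspec := Nat.find_spec hex
  set k := Nat.find hex with hk
  have hk2 : 2 ≤ k := by
    by_contra h
    have : k ≤ 1 := by omega
    have : k ^ 3 ≤ 1 ^ 3 := Nat.pow_le_pow_left this 3
    omega
  have hlt : (k - 1) ^ 3 < 2 * n := by
    have := Nat.find_min hex (m := k - 1) (by omega)
    omega
  have hle : k ^ 3 ≤ (2 * (k - 1)) ^ 3 := Nat.pow_le_pow_left (by omega) 3
  rw [mul_pow] at hle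
  exact ⟨k, by omega, hspec, by omega⟩

/-- One step, with the parameters chosen. -/
lemma one_step' {V : Type*} [Fintype V] (G : SimpleGraph V) (σ : V → ℕ)
    (hσ : IsProperColoring G σ) (s₁ s₂ : ℕ)
    (h1 : ∀ v, SetCol G (ballSet G v 1) s₁) (h2 : ∀ v, SetCol G (ballSet G v 2) s₂)
    (S : Set V) (n : ℕ) (hn : 1 ≤ n) (hn2 : (σ '' S).ncard ≤ 2 * n)
    (hN : (256 * (s₂ + 16) ^ 3) ^ 4 ≤ n) :
    ∃ (Y : Set V) (m : ℕ), Y ⊆ S ∧ SetCol G Y s₁ ∧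
      SetCol G {v | v ∈ S ∧ σ v ∉ σ '' Y} m ∧ m ^ 12 ≤ n ^ 9 := by
  obtain ⟨k, hk, hk1, hk2⟩ := exists_params n hn
  obtain ⟨q, hq, hq1, hq2⟩ := Nat.exists_prime_lt_and_le_two_mul (2 * k) (by omega)
  have hkq : k ^ 3 ≤ q ^ 3 := Nat.pow_le_pow_left (by omega) 3
  obtain ⟨Y, j, hY, hj, hc1, hc2⟩ := one_step G σ hσ s₁ s₂ h1 h2 S k q hk hq hq1.le (by omega)
  have hjk : j ≤ k ^ 2 := by
    have : j * k ≤ k ^ 2 * k := by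
      calc j * k ≤ k ^ 3 := by omega
        _ = _ := by ring
    exact Nat.le_of_mul_le_mul_right this hk
  have hqq : q * q ≤ 16 * k ^ 2 := by
    calc q * q ≤ (4 * k) * (4 * k) := Nat.mul_le_mul (by omega) (by omega)
      _ = _ := by ring
  refine ⟨Y, (s₂ + 16) * k ^ 2, hY, hc1, hc2.mono subset_rfl ?_, ?_⟩
  · have := Nat.mul_le_mul_left s₂ hjk
    rw [add_mul]; omega
  · calc ((s₂ + 16) * k ^ 2) ^ 12 = (s₂ + 16) ^ 12 * (k ^ 3) ^ 8 := by ring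
      _ ≤ (s₂ + 16) ^ 12 * (16 * n) ^ 8 := by gcongr
      _ = (256 * (s₂ + 16) ^ 3) ^ 4 * n ^ 8 := by ring
      _ ≤ n * n ^ 8 := by gcongr
      _ = n ^ 9 := by ring

lemma loglog_ge (n : ℕ) : -1 ≤ Real.log (Real.log n) := by
  rcases Nat.lt_or_ge n 2 with h | h
  · interval_cases n <;> simp
  · have h2 : Real.log 2 ≤ Real.log n := Real.log_le_log (by norm_num) (by exact_mod_cast h)
    have h3 := Real.log_two_gt_d9
    have h4 : (1 / 2 : ℝ) ≤ Real.log n := by linarith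
    have h5 := Real.log_le_log (by norm_num) h4
    have h6 : Real.log (1 / 2 : ℝ) = - Real.log 2 := by
      rw [one_div, Real.log_inv]
    have := Real.log_two_lt_d9
    linarith

lemma loglog_step (n m : ℕ) (hn : 256 ≤ n) (h : m ^ 12 ≤ n ^ 9) :
    Real.log (Real.log m) + 1 / 4 ≤ Real.log (Real.log n) := by
  have hnR : (256 : ℝ) ≤ n := by exact_mod_cast hn
  have hlogn : (2 : ℝ) ≤ Real.log n := by
    have h1 : Real.log 256 ≤ Real.log n := Real.log_le_log (by norm_num) hnR
    have h2 : Real.log 256 = 8 * Real.log 2 := by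
      rw [show (256 : ℝ) = 2 ^ 8 by norm_num, Real.log_pow]; norm_num
    have h3 := Real.log_two_gt_d9
    linarith
  rcases Nat.lt_or_ge m 2 with hm | hm
  · have h0 : Real.log (Real.log m) = 0 := by interval_cases m <;> simp
    have h1 : Real.log 2 ≤ Real.log (Real.log n) := Real.log_le_log (by norm_num) hlogn
    have h3 := Real.log_two_gt_d9
    linarith
  · have hmR : (2 : ℝ) ≤ m := by exact_mod_cast hm
    have hlogm : 0 < Real.log m := Real.log_pos (by linarith)
    have h1 : ((m : ℝ)) ^ 12 ≤ (n : ℝ) ^ 9 := by exact_mod_cast h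
    have h2 := Real.log_le_log (by positivity) h1
    rw [Real.log_pow, Real.log_pow] at h2
    push_cast at h2
    have h3 : Real.log m * (4 / 3) ≤ Real.log n := by linarith
    have h4 := Real.log_le_log (by positivity) h3
    rw [Real.log_mul hlogm.ne' (by norm_num)] at h4
    have h5 := Real.one_sub_inv_le_log_of_pos (show (0 : ℝ) < 4 / 3 by norm_num)
    norm_num at h5
    linarith

/-- The main induction. -/
lemma main_induction {V : Type*} [Fintype V] (G : SimpleGraph V) (σ : V → ℕ)
    (hσ : IsProperColoring G σ) (s₁ s₂ : ℕ) (hs₂ : 1 ≤ s₂)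
    (h1 : ∀ v, SetCol G (ballSet G v 1) s₁) (h2 : ∀ v, SetCol G (ballSet G v 2) s₂)
    (n : ℕ) : ∀ S : Set V, chromNum (G.induce S) = n → ∃ X ⊆ S,
      ((σ '' X).ncard : ℝ) - (chromNum (G.induce X) : ℝ) ≥
        (n : ℝ) - 4 * s₁ * s₂ * Real.log (Real.log n)
          - (((256 * (s₂ + 16) ^ 3) ^ 4 : ℕ) + 4 * s₁ * s₂ : ℝ) := by
  induction n using Nat.strong_induction_on with
  | _ n ih =>
  intro S hS
  set N0 : ℕ := (256 * (s₂ + 16) ^ 3) ^ 4 with hN0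
  have hA : (0 : ℝ) ≤ 4 * s₁ * s₂ := by positivity
  have hlow : (4 * s₁ * s₂ : ℝ) * (-1) ≤ 4 * s₁ * s₂ * Real.log (Real.log n) :=
    mul_le_mul_of_nonneg_left (loglog_ge n) hA
  by_cases hn : n < N0
  · refine ⟨∅, Set.empty_subset _, ?_⟩
    have h0 : chromNum (G.induce (∅ : Set V)) ≤ 0 :=
      (setCol_iff G ∅ 0).1 ⟨fun _ => 0, by simp, by simp⟩
    have h0' : chromNum (G.induce (∅ : Set V)) = 0 := by omega
    have hnR : (n : ℝ) < N0 := by exact_mod_cast hn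
    rw [h0']
    simp only [Set.image_empty, Set.ncard_empty, Nat.cast_zero, sub_zero]
    linarith
  push Not at hn
  have hN256 : 256 ≤ N0 := by
    have : 1 ≤ (s₂ + 16) ^ 3 := Nat.one_le_pow _ _ (by omega)
    calc 256 ≤ 256 * (s₂ + 16) ^ 3 := by omega
      _ ≤ N0 := Nat.le_self_pow (by norm_num) _
  by_cases hp : 2 * n ≤ (σ '' S).ncard
  · refine ⟨S, subset_rfl, ?_⟩
    rw [hS]
    have : (2 * n : ℝ) ≤ (σ '' S).ncard := by exact_mod_cast hp
    have hN0' : (0 : ℝ) ≤ N0 := by positivity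
    linarith
  push Not at hp
  obtain ⟨Y, m, hYS, hY, hR, hm⟩ :=
    one_step' G σ hσ s₁ s₂ h1 h2 S n (by omega) hp.le hn
  clear_value N0
  set R : Set V := {v | v ∈ S ∧ σ v ∉ σ '' Y} with hRdef
  set n' := chromNum (G.induce R) with hn'
  have hn'm : n' ≤ m := (setCol_iff G R m).1 hR
  have hm' : n' ^ 12 ≤ n ^ 9 := (Nat.pow_le_pow_left hn'm 12).trans hm
  have hlt : n' < n := by
    by_contra hcon
    push Not at hcon
    have h3 : n ^ 12 ≤ n ^ 9 := (Nat.pow_le_pow_left hcon 12).trans hm'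
    have h4 : n ^ 9 < n ^ 12 := Nat.pow_lt_pow_right (by omega) (by norm_num)
    omega
  obtain ⟨X, hXR, hX⟩ := ih n' hlt R hn'.symm
  refine ⟨Y ∪ X, Set.union_subset hYS (fun v hv => (hXR hv).1), ?_⟩
  have hcols : (σ '' (Y ∪ X)).ncard = (σ '' Y).ncard + (σ '' X).ncard := by
    rw [Set.image_union, Set.ncard_union_eq ?_ (Set.toFinite _) (Set.toFinite _)]
    rw [Set.disjoint_right]
    rintro c ⟨u, hu, rfl⟩
    exact (hXR hu).2
  have hchi : chromNum (G.induce (Y ∪ X)) ≤ s₁ + chromNum (G.induce X) :=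
    (setCol_iff G _ _).1 (hY.union ((setCol_iff G X _).2 le_rfl))
  -- the chromatic number of the rest
  have hrest : n ≤ (σ '' Y).ncard + n' := by
    rw [← hS]
    apply (setCol_iff G S _).1
    have hcY : SetCol G {v | σ v ∈ σ '' Y} (σ '' Y).ncard := by
      have hfin : (σ '' Y).Finite := Set.toFinite _
      have hc : hfin.toFinset.card = (σ '' Y).ncard := (Set.ncard_eq_toFinset_card _ hfin).symm
      let ι := hfin.toFinset.equivFinOfCardEq hc
      refine ⟨fun v => if h : σ v ∈ hfin.toFinset then (ι ⟨σ v, h⟩ : ℕ) else 0, ?_, ?_⟩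
      · intro v hv
        have hv' : σ v ∈ hfin.toFinset := hfin.mem_toFinset.2 hv
        simp only [hv', dif_pos]
        exact (ι _).2
      · intro u hu v hv huv h
        have hu' : σ u ∈ hfin.toFinset := hfin.mem_toFinset.2 hu
        have hv' : σ v ∈ hfin.toFinset := hfin.mem_toFinset.2 hv
        simp only [hu', hv', dif_pos] at h
        have := ι.injective (Fin.ext h)
        exact hσ huv (Subtype.mk.inj this)
    apply (hcY.union ((setCol_iff G R n').2 le_rfl)).mono _ le_rfl
    intro v hv
    by_cases h : σ v ∈ σ '' Y
    · exact Or.inl h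
    · exact Or.inr ⟨hv, h⟩
  have hstep := loglog_step n n' (by omega) hm'
  have hstep2 := mul_le_mul_of_nonneg_left hstep hA
  have hs : (s₁ : ℝ) ≤ 4 * s₁ * s₂ * (1 / 4) := by
    have : (1 : ℝ) ≤ s₂ := by exact_mod_cast hs₂
    have h0 : (0 : ℝ) ≤ s₁ := by positivity
    have h3 := mul_le_mul_of_nonneg_left this h0
    linarith
  have hchiR : (chromNum (G.induce (Y ∪ X)) : ℝ) ≤ s₁ + chromNum (G.induce X) := by
    exact_mod_cast hchi
  have hrestR : (n : ℝ) ≤ (σ '' Y).ncard + n' := by exact_mod_cast hrest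
  rw [hcols]
  push_cast at hX ⊢
  linarith

/-- For all integers `s₁, s₂ ≥ 2` there is a constant `C ≥ 0` such that
every finite graph `G` with at least one vertex that is `1`-locally `s₁`-colourable and
`2`-locally `s₂`-colourable satisfies `φ(G) ≥ χ(G) - 4·s₁·s₂·ln(ln(χ(G))) - C`. -/
theorem twoLocallyColourable_chromDisc (s₁ s₂ : ℕ) (hs₁ : 2 ≤ s₁) (hs₂ : 2 ≤ s₂) :
    ∃ C : ℝ, 0 ≤ C ∧ ∀ (V : Type) [Fintype V] [Nonempty V] (G : SimpleGraph V),
      RLocallyColorable G 1 s₁ → RLocallyColorable G 2 s₂ →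
      (chromDisc G : ℝ) ≥
        (chromNum G : ℝ) - 4 * s₁ * s₂ * Real.log (Real.log (chromNum G)) - C := by
  refine ⟨(((256 * (s₂ + 16) ^ 3) ^ 4 : ℕ) + 4 * s₁ * s₂ : ℝ), by positivity, ?_⟩
  intro V _ _ G h1 h2
  have h1' : ∀ v, SetCol G (ballSet G v 1) s₁ := fun v => (setCol_iff G _ _).2 (h1 v)
  have h2' : ∀ v, SetCol G (ballSet G v 2) s₂ := fun v => (setCol_iff G _ _).2 (h2 v)
  have hnonempty : {z : ℤ | ∃ σ : V → ℕ, IsProperColoring G σ ∧ z = colDisc G σ}.Nonempty := by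
    refine ⟨_, fun v => (Fintype.equivFin V v : ℕ), ?_, rfl⟩
    intro u v huv h
    exact huv.ne ((Fintype.equivFin V).injective (Fin.ext h))
  have huniv : chromNum (G.induce (Set.univ : Set V)) = chromNum G := by
    unfold chromNum
    congr 1
    ext n
    exact ⟨fun h => h.of_hom (SimpleGraph.induceUnivIso G).symm.toHom,
      fun h => h.of_hom (SimpleGraph.induceUnivIso G).toHom⟩
  rw [ge_iff_le, ← Int.ceil_le]
  apply le_csInf hnonempty
  rintro z ⟨σ, hσ, rfl⟩
  obtain ⟨X, -, hX⟩ := main_induction G σ hσ s₁ s₂ (by omega) h1' h2' (chromNum G) Set.univ huniv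
  have hle : ((σ '' X).ncard : ℤ) - (chromNum (G.induce X) : ℤ) ≤ colDisc G σ := by
    unfold colDisc
    refine le_csSup ?_ ⟨X, rfl⟩
    refine ⟨(Nat.card V : ℤ), ?_⟩
    rintro z ⟨S, rfl⟩
    have h3 : (σ '' S).ncard ≤ S.ncard := Set.ncard_image_le (Set.toFinite _)
    have h4 : S.ncard ≤ Nat.card V := by
      rw [← Set.ncard_univ]
      exact Set.ncard_le_ncard (Set.subset_univ _) (Set.toFinite _)
    omega
  refine le_trans ?_ hle
  rw [Int.ceil_le]
  push_cast at hX ⊢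
  linarith
end
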